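/- For every connected signed graph G=(V,E⁺,E⁻) with V nonempty, a_so(G) ≥ δ⁺(G)+1; that is, every nonempty offensive alliance of G has size at least δ⁺(G)+1. -/

import Mathlib

/-- A signed graph on a vertex type `V`: a set of positive edges and a set of
negative edges, given as two simple graphs with disjoint edge sets. -/
structure SignedGraph (V : Type*) where
  pos : SimpleGraph V
  neg : SimpleGraph V
  disj : ∀ u v : V, ¬ (pos.Adj u v ∧ neg.Adj u v)

namespace SignedGraph

variable {V : Type*}

/-- The positive neighborhood `N⁺(v)`. -/
def Np (G : SignedGraph V) (v : V) : Set V := {u | G.pos.Adj v u}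

/-- The negative neighborhood `N⁻(v)`. -/
def Nn (G : SignedGraph V) (v : V) : Set V := {u | G.neg.Adj v u}

/-- The (open) neighborhood `N(v) = N⁺(v) ∪ N⁻(v)`. -/
def Nbr (G : SignedGraph V) (v : V) : Set V := G.Np v ∪ G.Nn v

/-- The positive degree `deg⁺(v)`. -/
noncomputable def degp (G : SignedGraph V) (v : V) : ℕ := (G.Np v).ncard

/-- The negative degree `deg⁻(v)`. -/
noncomputable def degn (G : SignedGraph V) (v : V) : ℕ := (G.Nn v).ncard

/-- The positive degree with respect to a set `S`: `deg⁺_S(v) = |N⁺(v) ∩ S|`. -/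
noncomputable def degpIn (G : SignedGraph V) (S : Set V) (v : V) : ℕ := (G.Np v ∩ S).ncard

/-- The negative degree with respect to a set `S`: `deg⁻_S(v) = |N⁻(v) ∩ S|`. -/
noncomputable def degnIn (G : SignedGraph V) (S : Set V) (v : V) : ℕ := (G.Nn v ∩ S).ncard

/-- The boundary `∂S = (⋃_{v ∈ S} N(v)) \ S`. -/
def boundary (G : SignedGraph V) (S : Set V) : Set V := (⋃ v ∈ S, G.Nbr v) \ S

/-- `S` is an offensive alliance: every boundary vertex `v` satisfies
`deg⁻_S(v) ≥ deg⁺_S(v)` and `deg⁻_S(v) ≥ deg⁺_{S̄}(v) + 1`. -/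
def IsOffensive (G : SignedGraph V) (S : Set V) : Prop :=
  ∀ v ∈ G.boundary S,
    G.degpIn S v ≤ G.degnIn S v ∧ G.degpIn Sᶜ v + 1 ≤ G.degnIn S v

/-- The offensive alliance number `a_so(G)`: the least size of a nonempty offensive alliance. -/
noncomputable def aso (G : SignedGraph V) : ℕ :=
  sInf {n | ∃ S : Set V, S.Nonempty ∧ G.IsOffensive S ∧ S.ncard = n}

/-- `S` is a minimum-size nonempty offensive alliance. -/
def IsMinOffensive (G : SignedGraph V) (S : Set V) : Prop :=
  S.Nonempty ∧ G.IsOffensive S ∧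
    ∀ T : Set V, T.Nonempty → G.IsOffensive T → S.ncard ≤ T.ncard

/-- The minimum positive degree `δ⁺(G)`. -/
noncomputable def minPosDeg (G : SignedGraph V) : ℕ := sInf (Set.range G.degp)

/-- The maximum negative degree `Δ⁻(G)`. -/
noncomputable def maxNegDeg (G : SignedGraph V) : ℕ := sSup (Set.range G.degn)

/-- The underlying unsigned graph `(V, E⁺ ∪ E⁻)`. -/
def underlying (G : SignedGraph V) : SimpleGraph V := G.pos ⊔ G.neg

/-- `G` is connected if its underlying unsigned graph is connected. -/
def Connected (G : SignedGraph V) : Prop := G.underlying.Connected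

/-- `G` is a complete signed graph that is (weakly) `k`-balanced with positive components
`P 0, …, P (k-1)`: the `P i` are nonempty, pairwise disjoint, cover `V`, the positive edges
are exactly the pairs of distinct vertices inside a common part, and the negative edges are
exactly the pairs of distinct vertices in no common part. -/
def IsKBalanced (G : SignedGraph V) (k : ℕ) (P : Fin k → Set V) : Prop :=
  (∀ i, (P i).Nonempty) ∧
  (∀ i j : Fin k, i ≠ j → Disjoint (P i) (P j)) ∧
  (⋃ i, P i) = Set.univ ∧
  (∀ u v : V, G.pos.Adj u v ↔ u ≠ v ∧ ∃ i, u ∈ P i ∧ v ∈ P i) ∧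
  (∀ u v : V, G.neg.Adj u v ↔ u ≠ v ∧ ¬ ∃ i, u ∈ P i ∧ v ∈ P i)

/-- `G` is a complete signed graph that is (weakly) `k`-anti-balanced with negative components
`P 0, …, P (k-1)`. -/
def IsKAntiBalanced (G : SignedGraph V) (k : ℕ) (P : Fin k → Set V) : Prop :=
  (∀ i, (P i).Nonempty) ∧
  (∀ i j : Fin k, i ≠ j → Disjoint (P i) (P j)) ∧
  (⋃ i, P i) = Set.univ ∧
  (∀ u v : V, G.neg.Adj u v ↔ u ≠ v ∧ ∃ i, u ∈ P i ∧ v ∈ P i) ∧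
  (∀ u v : V, G.pos.Adj u v ↔ u ≠ v ∧ ¬ ∃ i, u ∈ P i ∧ v ∈ P i)

/-- `V` can be partitioned into `t` classes such that vertices in a common class have the same
positive neighborhoods and the same negative neighborhoods (up to each other). -/
def GoodSndPartition (G : SignedGraph V) (t : ℕ) : Prop :=
  ∃ C : Fin t → Set V,
    (⋃ i, C i) = Set.univ ∧
    (∀ i j : Fin t, i ≠ j → Disjoint (C i) (C j)) ∧
    ∀ i : Fin t, ∀ u ∈ C i, ∀ v ∈ C i,
      G.Np v \ {u} = G.Np u \ {v} ∧ G.Nn v \ {u} = G.Nn u \ {v}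

/-- The signed neighborhood diversity `snd(G)`. -/
noncomputable def snd (G : SignedGraph V) : ℕ := sInf {t | G.GoodSndPartition t}

/-- The signed subgraph induced on a set `W` of vertices. -/
def restrict (G : SignedGraph V) (W : Set V) : SignedGraph W where
  pos := G.pos.induce W
  neg := G.neg.induce W
  disj := fun u v h => G.disj u.val v.val h

end SignedGraph

namespace SignedGraph

theorem minPosDeg_le_degp {V : Type*} (G : SignedGraph V) (v : V) : G.minPosDeg ≤ G.degp v :=
  Nat.sInf_le ⟨v, rfl⟩

theorem degp_lt_card {V : Type*} [Finite V] (G : SignedGraph V) (v : V) :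
    G.degp v < (Set.univ : Set V).ncard :=
  Set.ncard_lt_ncard (Set.ssubset_univ_iff.2 fun h =>
    G.pos.irrefl (show v ∈ G.Np v from h ▸ Set.mem_univ v))

theorem degpIn_add_degpIn_compl {V : Type*} [Finite V] (G : SignedGraph V) (S : Set V) (v : V) :
    G.degpIn S v + G.degpIn Sᶜ v = G.degp v :=
  Set.ncard_inter_add_ncard_sdiff_eq_ncard (G.Np v) S

theorem degpIn_add_degnIn_le {V : Type*} [Finite V] (G : SignedGraph V) (S : Set V) (v : V) :
    G.degpIn S v + G.degnIn S v ≤ S.ncard := by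
  have hdisj : Disjoint (G.Np v ∩ S) (G.Nn v ∩ S) :=
    Set.disjoint_left.2 fun u hp hn => G.disj v u ⟨hp.1, hn.1⟩
  rw [degpIn, degnIn, ← Set.ncard_union_eq hdisj]
  exact Set.ncard_le_ncard (Set.union_subset Set.inter_subset_right Set.inter_subset_right)

theorem Connected.boundary_nonempty {V : Type*} {G : SignedGraph V} (hconn : G.Connected)
    {S : Set V} (hS : S.Nonempty) (hS' : S ≠ Set.univ) : (G.boundary S).Nonempty := by
  obtain ⟨u, hu⟩ := hS
  obtain ⟨w, hw⟩ := (Set.ne_univ_iff_exists_notMem S).1 hS'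
  obtain ⟨p⟩ := SimpleGraph.Connected.preconnected hconn u w
  obtain ⟨d, -, h₁, h₂⟩ := p.exists_boundary_dart S hu hw
  exact ⟨d.snd, Set.mem_biUnion h₁ d.adj, h₂⟩

theorem IsOffensive.minPosDeg_lt_ncard {V : Type*} [Finite V] {G : SignedGraph V}
    (hconn : G.Connected) {S : Set V} (hS : S.Nonempty) (hoff : G.IsOffensive S) :
    G.minPosDeg < S.ncard := by
  by_cases hS' : S = Set.univ
  · obtain ⟨v, -⟩ := hS
    exact hS' ▸ (G.minPosDeg_le_degp v).trans_lt (G.degp_lt_card v)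
  · obtain ⟨v, hv⟩ := hconn.boundary_nonempty hS hS'
    have h₁ := (hoff v hv).2
    have h₂ := G.minPosDeg_le_degp v
    have h₃ := G.degpIn_add_degpIn_compl S v
    have h₄ := G.degpIn_add_degnIn_le S v
    omega

theorem isOffensive_univ {V : Type*} (G : SignedGraph V) : G.IsOffensive Set.univ :=
  fun v hv => (hv.2 (Set.mem_univ v)).elim

end SignedGraph

theorem signed_aso_ge_minPosDeg {V : Type*} [Fintype V] [Nonempty V]
    (G : SignedGraph V) (hconn : G.Connected) :
    G.minPosDeg + 1 ≤ G.aso ∧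
      ∀ S : Set V, S.Nonempty → G.IsOffensive S → G.minPosDeg + 1 ≤ S.ncard := by
  have hbound : ∀ S : Set V, S.Nonempty → G.IsOffensive S → G.minPosDeg + 1 ≤ S.ncard :=
    fun S hS hoff => hoff.minPosDeg_lt_ncard hconn hS
  refine ⟨?_, hbound⟩
  obtain ⟨S, hS, hoff, hcard⟩ : G.aso ∈ {n | ∃ S : Set V, S.Nonempty ∧ G.IsOffensive S ∧
      S.ncard = n} := Nat.sInf_mem ⟨_, Set.univ, Set.univ_nonempty, G.isOffensive_univ, rfl⟩
  exact hcard ▸ hbound S hS hoff
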